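/- (Structural identifiability of the interaction kernel from a single full-spectrum profile.) Let σ = 1 and V ≡ 0. Let W and W₀ be even, L-periodic, twice continuously differentiable kernels with equal mass ∫_Ω W dx = ∫_Ω W₀ dx, and let u* : ℝ → ℝ be twice continuously differentiable, L-periodic, strictly positive, with ∫_Ω u* dx = 1 and with all Fourier coefficients nonzero (û*(k) ≠ 0 for every k ∈ ℤ). If u* solves the stationary equation for both kernels, i.e. d/dx(u*'(x) + κ u*(x) (W*u*)'(x)) = 0 and d/dx(u*'(x) + κ u*(x) (W₀*u*)'(x)) = 0 for all x ∈ ℝ with κ > 0, then W = W₀. -/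

import Mathlib

open MeasureTheory Real Set Complex

/-- Periodic convolution over Ω = (-L/2, L/2]: `(W*u)(x) = ∫_Ω W(x-y) u(y) dy`. -/
noncomputable def pconv (L : ℝ) (W u : ℝ → ℝ) (x : ℝ) : ℝ :=
  ∫ y in Set.Ioc (-(L/2)) (L/2), W (x - y) * u y

/-- The k-th Fourier coefficient of an L-periodic function:
`f̂(k) = (1/L) ∫_Ω f(x) exp(-2πi k x / L) dx`. -/
noncomputable def fCoeff (L : ℝ) (f : ℝ → ℝ) (k : ℤ) : ℂ :=
  (1 / (L : ℂ)) * ∫ x in Set.Ioc (-(L/2)) (L/2),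
    (f x : ℂ) * Complex.exp (-(2 * (Real.pi : ℂ) * Complex.I * (k : ℂ) * (x : ℂ)) / (L : ℂ))

/-- Differentiation under the integral sign for the periodic convolution. -/
lemma hasDerivAt_pconv (L : ℝ) {W u : ℝ → ℝ} (hW : ContDiff ℝ 1 W) (hu : Continuous u) (x : ℝ) :
    HasDerivAt (pconv L W u) (pconv L (deriv W) u x) x := by
  have hW' : Continuous (deriv W) := hW.continuous_deriv le_rfl
  obtain ⟨C, hC⟩ := (isCompact_Icc (a := x - 1 - L / 2) (b := x + 1 + L / 2))
    |>.exists_bound_of_continuousOn hW'.continuousOn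
  have hint : ∀ f : ℝ → ℝ, Continuous f → IntegrableOn f (Set.Ioc (-(L/2)) (L/2)) := fun f hf =>
    (hf.integrableOn_Icc).mono_set Set.Ioc_subset_Icc_self
  refine (hasDerivAt_integral_of_dominated_loc_of_deriv_le
    (μ := volume.restrict (Set.Ioc (-(L/2)) (L/2)))
    (F := fun z y => W (z - y) * u y) (F' := fun z y => deriv W (z - y) * u y)
    (bound := fun y => C * ‖u y‖) (s := Metric.ball x 1) (Metric.ball_mem_nhds x one_pos)
    ?_ ?_ ?_ ?_ ?_ ?_).2
  · refine Filter.Eventually.of_forall fun z => Continuous.aestronglyMeasurable ?_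
    have := hW.continuous
    fun_prop
  · have := hW.continuous
    exact hint _ (by fun_prop)
  · exact Continuous.aestronglyMeasurable (by fun_prop)
  · refine (ae_restrict_iff' measurableSet_Ioc).2 (Filter.Eventually.of_forall fun y hy z hz => ?_)
    rw [norm_mul]
    refine mul_le_mul_of_nonneg_right (hC _ ?_) (norm_nonneg _)
    rw [Metric.mem_ball, Real.dist_eq, abs_lt] at hz
    constructor <;> linarith [hy.1, hy.2, hz.1, hz.2]
  · exact hint _ (by fun_prop)
  · refine Filter.Eventually.of_forall fun y z _ => ?_
    have h := ((hW.differentiable one_ne_zero).differentiableAt (x := z - y)).hasDerivAt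
    exact (h.comp_sub_const z y).mul_const (u y)

lemma pconv_periodic {L : ℝ} {W : ℝ → ℝ} (hW : Function.Periodic W L) (u : ℝ → ℝ) :
    Function.Periodic (pconv L W u) L := fun x => by
  simp only [pconv, add_sub_right_comm, hW _]

lemma pconv_sub (L : ℝ) {V W u : ℝ → ℝ} (hV : Continuous V) (hW : Continuous W)
    (hu : Continuous u) (x : ℝ) :
    pconv L (fun z => V z - W z) u x = pconv L V u x - pconv L W u x := by
  simp only [pconv, sub_mul]
  refine integral_sub ?_ ?_ <;>
  exact (Continuous.integrableOn_Icc (by fun_prop)).mono_set Set.Ioc_subset_Icc_self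

/-- The convolution theorem for Fourier coefficients on a period. -/
lemma fCoeff_pconv {L : ℝ} (hL : 0 < L) {D u : ℝ → ℝ} (hD : Continuous D)
    (hDper : Function.Periodic D L) (hu : Continuous u) (k : ℤ) :
    fCoeff L (pconv L D u) k = L * (fCoeff L D k * fCoeff L u k) := by
  have hLc : (L : ℂ) ≠ 0 := Complex.ofReal_ne_zero.2 hL.ne'
  set e : ℝ → ℂ := fun x =>
    Complex.exp (-(2 * (Real.pi : ℂ) * Complex.I * (k : ℂ) * (x : ℂ)) / (L : ℂ)) with he
  have hec : Continuous e := by fun_prop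
  have hadd : ∀ x y, e (x + y) = e x * e y := fun x y => by
    simp only [he, ← Complex.exp_add]
    congr 1
    push_cast
    ring
  have heL : e L = 1 := by
    simp only [he]
    rw [Complex.exp_eq_one_iff]
    refine ⟨-k, ?_⟩
    push_cast
    field_simp
  have hper : Function.Periodic (fun x => (D x : ℂ) * e x) L := fun x => by
    simp only [hDper x, hadd, heL, mul_one]
  have hshift : ∀ y, (∫ x in Set.Ioc (-(L/2)) (L/2), (D (x - y) : ℂ) * e (x - y)) =
      ∫ x in Set.Ioc (-(L/2)) (L/2), (D x : ℂ) * e x := fun y => by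
    have hle : -(L/2) ≤ L/2 := by linarith
    rw [← intervalIntegral.integral_of_le hle, ← intervalIntegral.integral_of_le hle,
      intervalIntegral.integral_comp_sub_right (fun x => (D x : ℂ) * e x) y]
    have := hper.intervalIntegral_add_eq (-(L/2) - y) (-(L/2))
    rwa [show -(L/2) - y + L = L/2 - y by ring, show -(L/2) + L = L/2 by ring] at this
  have hswap : (∫ x in Set.Ioc (-(L/2)) (L/2), (pconv L D u x : ℂ) * e x) =
      (∫ x in Set.Ioc (-(L/2)) (L/2), (D x : ℂ) * e x) *
        ∫ y in Set.Ioc (-(L/2)) (L/2), (u y : ℂ) * e y := by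
    calc (∫ x in Set.Ioc (-(L/2)) (L/2), (pconv L D u x : ℂ) * e x)
        = ∫ x in Set.Ioc (-(L/2)) (L/2), ∫ y in Set.Ioc (-(L/2)) (L/2),
            ((D (x - y) : ℂ) * e (x - y)) * ((u y : ℂ) * e y) := by
          refine integral_congr_ae (Filter.Eventually.of_forall fun x => ?_)
          simp only [pconv]
          rw [← integral_complex_ofReal, ← integral_mul_const]
          refine integral_congr_ae (Filter.Eventually.of_forall fun y => ?_)
          have h := hadd (x - y) y
          rw [sub_add_cancel] at h
          simp only [h]
          push_cast
          ring
      _ = ∫ y in Set.Ioc (-(L/2)) (L/2), ∫ x in Set.Ioc (-(L/2)) (L/2),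
            ((D (x - y) : ℂ) * e (x - y)) * ((u y : ℂ) * e y) := by
          refine integral_integral_swap ?_
          rw [Measure.prod_restrict]
          refine IntegrableOn.mono_set ?_
            (Set.prod_mono Set.Ioc_subset_Icc_self Set.Ioc_subset_Icc_self)
          refine ContinuousOn.integrableOn_compact (isCompact_Icc.prod isCompact_Icc) ?_
          refine Continuous.continuousOn ?_
          unfold Function.uncurry
          fun_prop
      _ = _ := by
          simp only [integral_mul_const, hshift, integral_const_mul]
  have hcoeff : ∀ f : ℝ → ℝ, fCoeff L f k =
      (1 / (L : ℂ)) * ∫ x in Set.Ioc (-(L/2)) (L/2), (f x : ℂ) * e x := fun _ => rfl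
  rw [hcoeff, hcoeff, hcoeff, hswap]
  field_simp

lemma fCoeff_const {L : ℝ} (hL : 0 < L) (c : ℝ) {k : ℤ} (hk : k ≠ 0) :
    fCoeff L (fun _ => c) k = 0 := by
  have hLc : (L : ℂ) ≠ 0 := Complex.ofReal_ne_zero.2 hL.ne'
  have hkc : (k : ℂ) ≠ 0 := Int.cast_ne_zero.2 hk
  have hpi : (Real.pi : ℂ) ≠ 0 := Complex.ofReal_ne_zero.2 Real.pi_ne_zero
  have hω : -(2 * (Real.pi : ℂ) * Complex.I * (k : ℂ)) / (L : ℂ) ≠ 0 := by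
    simp [hLc, hkc, hpi]
  have hends :
      Complex.exp (-(2 * (Real.pi : ℂ) * Complex.I * (k : ℂ)) / (L : ℂ) * ((L/2 : ℝ) : ℂ)) =
        Complex.exp (-(2 * (Real.pi : ℂ) * Complex.I * (k : ℂ)) / (L : ℂ) *
          ((-(L/2) : ℝ) : ℂ)) := by
    rw [Complex.exp_eq_exp_iff_exists_int]
    refine ⟨-k, ?_⟩
    push_cast
    field_simp
    ring
  have hform : ∀ x : ℝ, -(2 * (Real.pi : ℂ) * Complex.I * (k : ℂ) * (x : ℂ)) / (L : ℂ) =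
      -(2 * (Real.pi : ℂ) * Complex.I * (k : ℂ)) / (L : ℂ) * (x : ℂ) := fun x => by ring
  simp only [fCoeff, hform]
  rw [integral_const_mul, ← intervalIntegral.integral_of_le (by linarith),
    integral_exp_mul_complex hω, hends]
  simp

/-- A continuous periodic function is determined by its Fourier coefficients. -/
lemma eq_zero_of_fCoeff_eq_zero {L : ℝ} (hL : 0 < L) {D : ℝ → ℝ} (hD : Continuous D)
    (hDper : Function.Periodic D L) (h : ∀ k, fCoeff L D k = 0) (x : ℝ) : D x = 0 := by
  have : Fact (0 < L) := ⟨hL⟩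
  have hper : Function.Periodic (fun x => (D x : ℂ)) L := fun x => by simp only [hDper x]
  let f : C(AddCircle L, ℂ) :=
    ⟨hper.lift, continuous_quot_lift _ (Complex.continuous_ofReal.comp hD)⟩
  have hcoeff : fourierCoeff f = fun _ => 0 := by
    funext k
    rw [fourierCoeff_eq_intervalIntegral f k (-(L/2)), ← h k, fCoeff,
      intervalIntegral.integral_of_le (by linarith), show -(L/2) + L = L/2 by ring,
      Complex.real_smul]
    push_cast
    congr 1
    refine integral_congr_ae (Filter.Eventually.of_forall fun y => ?_)
    change fourier (-k) (y : AddCircle L) • (D y : ℂ) = _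
    rw [fourier_coe_apply, smul_eq_mul, mul_comm]
    congr 2
    push_cast
    ring
  have hsum := has_pointwise_sum_fourier_series_of_summable (f := f)
    (by rw [hcoeff]; exact summable_zero) (x : AddCircle L)
  simp only [hcoeff, zero_smul] at hsum
  have hx : f (x : AddCircle L) = 0 := hsum.unique hasSum_zero
  exact Complex.ofReal_eq_zero.1 hx

/-- A differentiable periodic function whose derivative, multiplied by a positive continuous
weight, is constant, is itself constant. -/
lemma eq_of_mul_deriv_const_of_periodic {L : ℝ} (hL : 0 < L) {g g' u : ℝ → ℝ}
    (hg : ∀ x, HasDerivAt g (g' x) x) (hgper : Function.Periodic g L)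
    (hupos : ∀ x, 0 < u x) {c : ℝ} (hc : ∀ x, u x * g' x = c) (x y : ℝ) :
    g x = g y := by
  obtain ⟨z, -, hz⟩ := exists_hasDerivAt_eq_zero hL
    (fun x _ => (hg x).continuousAt.continuousWithinAt)
    (by simpa using (hgper 0).symm) (fun x _ => hg x)
  have hc0 : c = 0 := by rw [← hc z, hz, mul_zero]
  have hg0 : ∀ x, g' x = 0 := fun x =>
    (mul_eq_zero.1 ((hc x).trans hc0)).resolve_left (hupos x).ne'
  exact is_const_of_deriv_eq_zero (fun x => (hg x).differentiableAt)
    (fun x => (hg x).deriv.trans (hg0 x)) x y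

/-- The flux `u' + κ u (W * u)'` of a stationary profile is constant. -/
lemma flux_const {L κ : ℝ} {W u : ℝ → ℝ} (hW : ContDiff ℝ 2 W) (hu : ContDiff ℝ 2 u)
    (heq : ∀ x : ℝ, deriv (fun y => deriv u y + κ * u y * deriv (pconv L W u) y) x = 0)
    (x y : ℝ) :
    deriv u x + κ * u x * pconv L (deriv W) u x = deriv u y + κ * u y * pconv L (deriv W) u y := by
  have hW1 : ContDiff ℝ 1 W := hW.of_le one_le_two
  have hW' : ContDiff ℝ 1 (deriv W) := ((contDiff_succ_iff_deriv (n := 1)).1 hW).2.2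
  have hu' : ContDiff ℝ 1 (deriv u) := ((contDiff_succ_iff_deriv (n := 1)).1 hu).2.2
  have hpc : deriv (pconv L W u) = pconv L (deriv W) u :=
    funext fun z => (hasDerivAt_pconv L hW1 hu.continuous z).deriv
  rw [hpc] at heq
  refine is_const_of_deriv_eq_zero (fun z => ?_) heq x y
  have h1 := (hu'.differentiable one_ne_zero).differentiableAt (x := z)
  have h2 := (hu.differentiable two_ne_zero).differentiableAt (x := z)
  have h3 := (hasDerivAt_pconv L hW' hu.continuous z).differentiableAt
  exact h1.add ((h2.const_mul κ).mul h3)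

/-- Structural identifiability of the interaction kernel from a single
full-spectrum profile: with `σ = 1` and `V ≡ 0`, if the even, L-periodic, C² kernels `W`
and `W₀` have equal mass over Ω, and the C², L-periodic, strictly positive profile `u*` of
unit mass, all of whose Fourier coefficients are nonzero, solves the stationary equation
`d/dx(u*' + κ u* (W*u*)') = 0` for both kernels (with `κ > 0`), then `W = W₀`. -/
theorem kernel_identifiable (L κ : ℝ) (hL : 0 < L) (hκ : 0 < κ)
    (W W₀ : ℝ → ℝ)
    (hW : ContDiff ℝ 2 W) (hWper : Function.Periodic W L) (hWeven : ∀ x : ℝ, W (-x) = W x)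
    (hW₀ : ContDiff ℝ 2 W₀) (hW₀per : Function.Periodic W₀ L)
    (hW₀even : ∀ x : ℝ, W₀ (-x) = W₀ x)
    (hmass : (∫ x in Set.Ioc (-(L/2)) (L/2), W x) = ∫ x in Set.Ioc (-(L/2)) (L/2), W₀ x)
    (ustar : ℝ → ℝ) (hu : ContDiff ℝ 2 ustar) (huper : Function.Periodic ustar L)
    (hupos : ∀ x : ℝ, 0 < ustar x)
    (humass : (∫ x in Set.Ioc (-(L/2)) (L/2), ustar x) = 1)
    (hspec : ∀ k : ℤ, fCoeff L ustar k ≠ 0)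
    (heq1 : ∀ x : ℝ,
      deriv (fun y => deriv ustar y + κ * ustar y * deriv (pconv L W ustar) y) x = 0)
    (heq2 : ∀ x : ℝ,
      deriv (fun y => deriv ustar y + κ * ustar y * deriv (pconv L W₀ ustar) y) x = 0) :
    W = W₀ := by
  have hW1 : ContDiff ℝ 1 W := hW.of_le one_le_two
  have hW₀1 : ContDiff ℝ 1 W₀ := hW₀.of_le one_le_two
  have hDcont : Continuous (fun x => W x - W₀ x) := hW.continuous.sub hW₀.continuous
  have hDper : Function.Periodic (fun x => W x - W₀ x) L := hWper.sub hW₀per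
  have hg : ∀ x, HasDerivAt (pconv L (fun x => W x - W₀ x) ustar)
      (pconv L (deriv W) ustar x - pconv L (deriv W₀) ustar x) x := fun x => by
    rw [funext (pconv_sub L hW.continuous hW₀.continuous hu.continuous)]
    exact (hasDerivAt_pconv L hW1 hu.continuous x).sub (hasDerivAt_pconv L hW₀1 hu.continuous x)
  have hconst := eq_of_mul_deriv_const_of_periodic hL hg (pconv_periodic hDper ustar) hupos
    (c := ustar 0 * (pconv L (deriv W) ustar 0 - pconv L (deriv W₀) ustar 0)) fun x => by
      have h1 := flux_const hW hu heq1 x 0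
      have h2 := flux_const hW₀ hu heq2 x 0
      refine mul_left_cancel₀ hκ.ne' ?_
      linear_combination h1 - h2
  have hcoeff : ∀ k, fCoeff L (fun x => W x - W₀ x) k = 0 := fun k => by
    rcases eq_or_ne k 0 with rfl | hk
    · have hint : ∀ f : ℝ → ℝ, Continuous f → IntegrableOn f (Set.Ioc (-(L/2)) (L/2)) :=
        fun f hf => hf.integrableOn_Icc.mono_set Set.Ioc_subset_Icc_self
      have hzero : (∫ x in Set.Ioc (-(L/2)) (L/2), (W x - W₀ x)) = 0 := by
        rw [integral_sub (hint _ hW.continuous) (hint _ hW₀.continuous), hmass, sub_self]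
      simp only [fCoeff, Int.cast_zero, mul_zero, zero_mul, neg_zero, zero_div, Complex.exp_zero,
        mul_one]
      rw [integral_complex_ofReal, hzero, Complex.ofReal_zero, mul_zero]
    · have h := fCoeff_pconv hL hDcont hDper hu.continuous k
      rw [funext fun x => hconst x 0, fCoeff_const hL _ hk] at h
      have hLc : (L : ℂ) ≠ 0 := Complex.ofReal_ne_zero.2 hL.ne'
      exact (mul_eq_zero.1 ((mul_eq_zero.1 h.symm).resolve_left hLc)).resolve_right (hspec k)
  funext x
  exact sub_eq_zero.1 (eq_zero_of_fCoeff_eq_zero hL hDcont hDper hcoeff x)
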